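/- Let N = 2I be an even integer with N ≥ 4, let i_1, …, i_{N−1} be positive integers and let i_N be an integer with i_N > 1; work over the polynomial ring ℤ[t]. For 1 ≤ k ≤ N−1 set m_k = 2i_k and let B_k be the m_k×m_k matrix with diagonal entries 3−3t except the (m_k,m_k) entry which is 1−t, superdiagonal entries t−2, subdiagonal entries 2t−1, and zeros elsewhere; let B'_k be obtained from B_k by replacing its last column by the column with entry t in position m_k and zeros elsewhere. Set m = 2i_N and let B_N be the m×m matrix with diagonal entries 1 except the (m−1,m−1) entry which is 1−t and the (m,m) entry which is I−I·t, subdiagonal entries t, entries −t in column m−1 in rows 1 through m−2, entries −1 in column m in rows 1 through m−1, and zeros elsewhere; let B''_N be B_N with its last row and last column deleted, and let B'_N be B_N with its last row and its (m−1)-st column deleted. Let n = Σ_{j=1}^{N} 2i_j, let M_2 be the n×n block-diagonal matrix with diagonal blocks B_1, …, B_N, and let M_1 be the n×n matrix whose only nonzero entries are −1 in the last row at each column p_k = 2i_1 + ⋯ + 2i_k for k = 1, …, N−1, and t in the last column at each row p_k for k = 1, …, N−1. Then det(M_1 + M_2) = det B''_N · Σ_{j=1}^{N−1} ( det B'_j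 · ∏_{1 ≤ l ≤ N−1, l ≠ j} det B_l ) − t · det B'_N · ∏_{l=1}^{N−1} det B_l + (I − I·t) · det B''_N · ∏_{l=1}^{N−1} det B_l. -/

import Mathlib

open Polynomial

noncomputable section

open Classical

/-! Entry functions (on natural-number indices, 0-based) for the blocks appearing
in the Alexander-polynomial computation for the pretzel knot
`P(2 i 1 + 1, …, 2 i (N-1) + 1, 2 i N)` on an even number `N = 2 I` of tassels,
of which exactly the last has an even number `2 i N` of crossings. -/

/-- Entry `(a, b)` (0-based) of the `m × m` block `B_k` (for an odd tassel):
diagonal entries `3 - 3t`, except the last diagonal entry which is `1 - t`;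
superdiagonal entries `t - 2`; subdiagonal entries `2t - 1`; zeros elsewhere. -/
def oddBlockEntry (m a b : ℕ) : ℤ[X] :=
  if a = b then (if a + 1 = m then 1 - X else 3 - 3 * X)
  else if a + 1 = b then X - 2
  else if b + 1 = a then 2 * X - 1
  else 0

/-- Entry `(a, b)` (0-based) of `B'_k`: the block `B_k` with its last column
replaced by the column with `t` in the last position and zeros elsewhere. -/
def oddBlockEntry' (m a b : ℕ) : ℤ[X] :=
  if b + 1 = m then (if a + 1 = m then X else 0) else oddBlockEntry m a b

/-- Entry `(a, b)` (0-based) of the `m × m` block `B_N` (for the even tassel,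
`N = 2 * I`): diagonal entries `1` except the `(m-1, m-1)` entry `1 - t` and the
`(m, m)` entry `I - I t` (1-based); subdiagonal entries `t`; entries `-t` in
column `m-1` in rows `1` through `m-2`; entries `-1` in column `m` in rows `1`
through `m-1`; zeros elsewhere. -/
def evenBlockEntry (I m a b : ℕ) : ℤ[X] :=
  if b + 1 = m then
    (if a + 1 = m then (I : ℤ[X]) - (I : ℤ[X]) * X else -1)
  else if b + 2 = m then
    (if a + 1 = m then X else if a + 2 = m then 1 - X else -X)
  else if b + 1 = a then X
  else if a = b then 1
  else 0

/-- The block `B_k` for an odd tassel, as an `m × m` matrix. -/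
def oddBlock (m : ℕ) : Matrix (Fin m) (Fin m) ℤ[X] :=
  Matrix.of fun a b => oddBlockEntry m a b

/-- The block `B'_k`, as an `m × m` matrix. -/
def oddBlock' (m : ℕ) : Matrix (Fin m) (Fin m) ℤ[X] :=
  Matrix.of fun a b => oddBlockEntry' m a b

/-- `B''_N`: the block `B_N` with its last row and last column deleted. -/
def evenBlock'' (I m : ℕ) : Matrix (Fin (m - 1)) (Fin (m - 1)) ℤ[X] :=
  Matrix.of fun a b => evenBlockEntry I m a b

/-- `B'_N`: the block `B_N` with its last row and its `(m-1)`-st column deleted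
(so its columns are columns `1, …, m-2, m` of `B_N`, 1-based). -/
def evenBlock' (I m : ℕ) : Matrix (Fin (m - 1)) (Fin (m - 1)) ℤ[X] :=
  Matrix.of fun a b => evenBlockEntry I m a (if (b : ℕ) + 2 = m then m - 1 else b)

/-- `M_2`: the `n × n` block-diagonal matrix with diagonal blocks
`B_1, …, B_{N-1}, B_N` of sizes `2 i 1, …, 2 i (N-1), 2 i N`, where
`n = ∑_{j=1}^{N} 2 i j`.  The block `B_k` occupies the rows and columns `p` with
`∑_{j<k} 2 i j ≤ p < ∑_{j≤k} 2 i j` (0-based); all entries outside the diagonal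
blocks vanish. -/
def pretzelM2 (N I : ℕ) (i : ℕ → ℕ) :
    Matrix (Fin (∑ j ∈ Finset.Icc 1 N, 2 * i j)) (Fin (∑ j ∈ Finset.Icc 1 N, 2 * i j)) ℤ[X] :=
  Matrix.of fun p q =>
    ∑ k ∈ Finset.Icc 1 N,
      if (∑ j ∈ Finset.Icc 1 (k - 1), 2 * i j) ≤ (p : ℕ) ∧
          (p : ℕ) < (∑ j ∈ Finset.Icc 1 k, 2 * i j) ∧
          (∑ j ∈ Finset.Icc 1 (k - 1), 2 * i j) ≤ (q : ℕ) ∧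
          (q : ℕ) < (∑ j ∈ Finset.Icc 1 k, 2 * i j) then
        (if k = N then
          evenBlockEntry I (2 * i N) ((p : ℕ) - ∑ j ∈ Finset.Icc 1 (k - 1), 2 * i j)
            ((q : ℕ) - ∑ j ∈ Finset.Icc 1 (k - 1), 2 * i j)
        else
          oddBlockEntry (2 * i k) ((p : ℕ) - ∑ j ∈ Finset.Icc 1 (k - 1), 2 * i j)
            ((q : ℕ) - ∑ j ∈ Finset.Icc 1 (k - 1), 2 * i j))
      else 0

/-- `M_1`: the `n × n` matrix whose only nonzero entries are `-1` in the last row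
at each column `p_k = 2 i 1 + ⋯ + 2 i k`, for `k = 1, …, N-1`, and `t` in the last
column at each row `p_k`, for `k = 1, …, N-1` (1-based positions). -/
def pretzelM1 (N : ℕ) (i : ℕ → ℕ) :
    Matrix (Fin (∑ j ∈ Finset.Icc 1 N, 2 * i j)) (Fin (∑ j ∈ Finset.Icc 1 N, 2 * i j)) ℤ[X] :=
  Matrix.of fun p q =>
    (if (p : ℕ) + 1 = (∑ j ∈ Finset.Icc 1 N, 2 * i j) ∧
        (∃ k ∈ Finset.Icc 1 (N - 1), (q : ℕ) + 1 = ∑ j ∈ Finset.Icc 1 k, 2 * i j) then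
      (-1 : ℤ[X]) else 0)
    + (if (q : ℕ) + 1 = (∑ j ∈ Finset.Icc 1 N, 2 * i j) ∧
        (∃ k ∈ Finset.Icc 1 (N - 1), (p : ℕ) + 1 = ∑ j ∈ Finset.Icc 1 k, 2 * i j) then
      (X : ℤ[X]) else 0)

/-- Bordered determinant: if `D *ᵥ w = D.det • u`, then bordering `D` by the column `u`, the row `v`
and the corner `d` gives determinant `d * D.det - v ⬝ᵥ w`. -/
theorem det_bordered_of_mulVec_eq {R n : Type*} [CommRing R] [IsDomain R] [Fintype n]
    [DecidableEq n] (D : Matrix n n R) (u v w : n → R) (d : R) (hD : D.det ≠ 0)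
    (hw : D.mulVec w = D.det • u) :
    (Matrix.fromBlocks D (Matrix.of fun a (_ : Unit) => u a) (Matrix.of fun (_ : Unit) b => v b)
      (Matrix.of fun (_ _ : Unit) => d)).det = d * D.det - v ⬝ᵥ w := by
  have key : Matrix.fromBlocks D (Matrix.of fun a (_ : Unit) => u a)
      (Matrix.of fun (_ : Unit) b => v b) (Matrix.of fun (_ _ : Unit) => d) *
      Matrix.fromBlocks 1 (Matrix.of fun a (_ : Unit) => - w a) 0
        (Matrix.of fun (_ _ : Unit) => D.det) =
      Matrix.fromBlocks D 0 (Matrix.of fun (_ : Unit) b => v b)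
        (Matrix.of fun (_ _ : Unit) => d * D.det - v ⬝ᵥ w) := by
    rw [Matrix.fromBlocks_multiply]
    congr 1
    · simp
    · ext a b
      have := congrFun hw a
      simp only [Matrix.mulVec, dotProduct, Pi.smul_apply, smul_eq_mul] at this
      simp [Matrix.mul_apply, this, mul_comm]
    · simp
    · ext a b
      simp [Matrix.mul_apply, dotProduct]
      ring
  have hdet := congrArg Matrix.det key
  rw [Matrix.det_mul, Matrix.det_fromBlocks_zero₂₁, Matrix.det_fromBlocks_zero₁₂] at hdet
  simp only [Matrix.det_one, one_mul, Matrix.det_unique, Matrix.of_apply] at hdet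
  exact mul_right_cancel₀ hD (by rw [hdet, mul_comm])

theorem det_oddBlock_ne_zero (m : ℕ) : (oddBlock m).det ≠ 0 := by
  intro h
  have h2 := congrArg (Polynomial.evalRingHom (2 : ℤ)) h
  rw [RingHom.map_det, Matrix.det_of_isLowerTriangular, map_zero, Finset.prod_eq_zero_iff] at h2
  · obtain ⟨a, -, ha⟩ := h2
    simp only [oddBlock, oddBlockEntry, RingHom.mapMatrix_apply, Matrix.map_apply,
      Matrix.of_apply, if_true] at ha
    split_ifs at ha <;> simp at ha
  · intro a b hab
    have hab' : (a : ℕ) < b := hab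
    simp only [oddBlock, oddBlockEntry, RingHom.mapMatrix_apply, Matrix.map_apply,
      Matrix.of_apply]
    rw [if_neg (by omega)]
    split_ifs
    · simp
    · omega
    · simp

theorem det_evenBlock''_ne_zero (I m : ℕ) : (evenBlock'' I m).det ≠ 0 := by
  intro h
  have h0 := congrArg (Polynomial.evalRingHom (0 : ℤ)) h
  rw [RingHom.map_det, Matrix.det_of_isUpperTriangular, map_zero, Finset.prod_eq_zero_iff] at h0
  · obtain ⟨a, -, ha⟩ := h0
    have := a.isLt
    simp only [evenBlock'', evenBlockEntry, RingHom.mapMatrix_apply, Matrix.map_apply,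
      Matrix.of_apply] at ha
    rw [if_neg (by omega)] at ha
    split_ifs at ha <;> first | omega | simp at ha
  · intro a b hab
    have hab' : (b : ℕ) < a := hab
    have := a.isLt
    simp only [evenBlock'', evenBlockEntry, RingHom.mapMatrix_apply, Matrix.map_apply,
      Matrix.of_apply]
    rw [if_neg (by omega), if_neg (by omega)]
    split_ifs <;> first | omega | simp

/-- The number of rows occupied by the first `k` diagonal blocks. -/
def blockOffset (i : ℕ → ℕ) (k : ℕ) : ℕ := ∑ j ∈ Finset.Icc 1 k, 2 * i j

theorem blockOffset_mono (i : ℕ → ℕ) : Monotone (blockOffset i) := fun _ _ h =>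
  Finset.sum_le_sum_of_subset (Finset.Icc_subset_Icc_right h)

theorem blockOffset_eq (i : ℕ → ℕ) {k : ℕ} (hk : 1 ≤ k) :
    blockOffset i k = blockOffset i (k - 1) + 2 * i k := by
  obtain ⟨k, rfl⟩ := Nat.exists_eq_add_of_le' hk
  simp [blockOffset, Finset.sum_Icc_succ_top]

theorem eq_of_mem_block (i : ℕ → ℕ) {k l p : ℕ} (hkp : blockOffset i (k - 1) ≤ p)
    (hpk : p < blockOffset i k) (hlp : blockOffset i (l - 1) ≤ p) (hpl : p < blockOffset i l) :
    k = l := by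
  rcases lt_trichotomy k l with h | h | h
  · have := blockOffset_mono i (show k ≤ l - 1 by omega)
    omega
  · exact h
  · have := blockOffset_mono i (show l ≤ k - 1 by omega)
    omega

theorem pretzelM2_apply (N I : ℕ) (i : ℕ → ℕ) {k : ℕ} (hk : k ∈ Finset.Icc 1 N)
    (p q : Fin (∑ j ∈ Finset.Icc 1 N, 2 * i j)) (hkp : blockOffset i (k - 1) ≤ p)
    (hpk : (p : ℕ) < blockOffset i k) :
    pretzelM2 N I i p q =
      if blockOffset i (k - 1) ≤ (q : ℕ) ∧ (q : ℕ) < blockOffset i k then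
        (if k = N then
          evenBlockEntry I (2 * i N) (p - blockOffset i (k - 1)) (q - blockOffset i (k - 1))
        else
          oddBlockEntry (2 * i k) (p - blockOffset i (k - 1)) (q - blockOffset i (k - 1)))
      else 0 := by
  simp only [pretzelM2, Matrix.of_apply]
  rw [Finset.sum_eq_single_of_mem k hk]
  · refine if_congr ?_ rfl rfl
    exact ⟨fun h => h.2.2, fun h => ⟨hkp, hpk, h⟩⟩
  · intro l _ hlk
    rw [if_neg]
    rintro ⟨h1, h2, -⟩
    exact hlk (eq_of_mem_block i h1 h2 hkp hpk)

/-- The indices of the odd blocks, of the last block without its last index, and that index. -/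
abbrev BlockIndex (N : ℕ) (i : ℕ → ℕ) : Type :=
  ((Σ k : Finset.Icc 1 (N - 1), Fin (2 * i k)) ⊕ Fin (2 * i N - 1)) ⊕ Unit

/-- The position in the big matrix of a block index. -/
def blockPosition (N : ℕ) (i : ℕ → ℕ) : BlockIndex N i → ℕ
  | .inl (.inl ⟨k, a⟩) => blockOffset i (k - 1) + a
  | .inl (.inr a) => blockOffset i (N - 1) + a
  | .inr _ => blockOffset i (N - 1) + (2 * i N - 1)

theorem blockPosition_lt {N : ℕ} (hN : 1 ≤ N) (i : ℕ → ℕ) (hiN : 0 < i N)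
    (x : BlockIndex N i) : blockPosition N i x < blockOffset i N := by
  have h := blockOffset_eq i hN
  rcases x with (⟨⟨k, hk⟩, a⟩ | a) | _
  · have hk' := Finset.mem_Icc.1 hk
    have h1 := blockOffset_eq i hk'.1
    have h2 := blockOffset_mono i hk'.2
    have := a.isLt
    simp only [blockPosition] at *
    omega
  · have := a.isLt
    simp only [blockPosition]
    omega
  · simp only [blockPosition]
    omega

theorem blockPosition_injective (N : ℕ) (i : ℕ → ℕ) :
    Function.Injective (blockPosition N i) := by
  have hlt : ∀ (k : Finset.Icc 1 (N - 1)) (a : Fin (2 * i k)),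
      blockOffset i (k - 1) + a < blockOffset i k := fun k a => by
    have := blockOffset_eq i (Finset.mem_Icc.1 k.2).1
    have := a.isLt
    omega
  have hle : ∀ k : Finset.Icc 1 (N - 1), blockOffset i k ≤ blockOffset i (N - 1) := fun k =>
    blockOffset_mono i (Finset.mem_Icc.1 k.2).2
  rintro ((⟨k, a⟩ | a) | _) ((⟨l, b⟩ | b) | _) h <;> simp only [blockPosition] at h
  · have h1 := hlt k a
    have h2 := hlt l b
    obtain rfl : k = l := Subtype.ext
      (eq_of_mem_block i (Nat.le_add_right _ _) h1 (by omega) (by omega))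
    obtain rfl : a = b := Fin.ext (by omega)
    rfl
  · have := hlt k a
    have := hle k
    omega
  · have := hlt k a
    have := hle k
    omega
  · have := hlt l b
    have := hle l
    omega
  · obtain rfl : a = b := Fin.ext (by omega)
    rfl
  · have := a.isLt
    omega
  · have := hlt l b
    have := hle l
    omega
  · have := b.isLt
    omega
  · rfl

theorem card_blockIndex {N : ℕ} (hN : 1 ≤ N) (i : ℕ → ℕ) (hiN : 0 < i N) :
    Fintype.card (BlockIndex N i) = blockOffset i N := by
  rw [blockOffset_eq i hN, blockOffset, ← Finset.sum_coe_sort]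
  simp only [Fintype.card_sum, Fintype.card_sigma, Fintype.card_fin, Fintype.card_unit]
  omega

/-- The bijection between block indices and the indices of the big matrix. -/
def blockEquiv {N : ℕ} (hN : 1 ≤ N) (i : ℕ → ℕ) (hiN : 0 < i N) :
    BlockIndex N i ≃ Fin (∑ j ∈ Finset.Icc 1 N, 2 * i j) :=
  Equiv.ofBijective (fun x => ⟨blockPosition N i x, blockPosition_lt hN i hiN x⟩)
    ((Fintype.bijective_iff_injective_and_card _).2
      ⟨fun _ _ h => blockPosition_injective N i (Fin.ext_iff.1 h),
        (card_blockIndex hN i hiN).trans (Fintype.card_fin _).symm⟩)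

/-- The big matrix with its last row and column deleted. -/
def pretzelCore (N I : ℕ) (i : ℕ → ℕ) :
    Matrix ((Σ k : Finset.Icc 1 (N - 1), Fin (2 * i k)) ⊕ Fin (2 * i N - 1))
      ((Σ k : Finset.Icc 1 (N - 1), Fin (2 * i k)) ⊕ Fin (2 * i N - 1)) ℤ[X] :=
  Matrix.fromBlocks (Matrix.blockDiagonal' fun k : Finset.Icc 1 (N - 1) => oddBlock (2 * i k))
    0 0 (evenBlock'' I (2 * i N))

/-- The last row of the big matrix without its corner. -/
def pretzelRow (N : ℕ) (i : ℕ → ℕ) :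
    (Σ k : Finset.Icc 1 (N - 1), Fin (2 * i k)) ⊕ Fin (2 * i N - 1) → ℤ[X] :=
  Sum.elim (fun x => if (x.2 : ℕ) + 1 = 2 * i x.1 then -1 else 0)
    fun a => if (a : ℕ) + 2 = 2 * i N then X else 0

/-- The last column of the big matrix without its corner. -/
def pretzelCol (N : ℕ) (i : ℕ → ℕ) :
    (Σ k : Finset.Icc 1 (N - 1), Fin (2 * i k)) ⊕ Fin (2 * i N - 1) → ℤ[X] :=
  Sum.elim (fun x => if (x.2 : ℕ) + 1 = 2 * i x.1 then X else 0) fun _ => -1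

theorem det_blockDiagonal'_eq_prod {R o : Type*} [CommRing R] [Fintype o] [LinearOrder o]
    [DecidableEq o] {m : o → Type*} [∀ k, Fintype (m k)] [∀ k, DecidableEq (m k)]
    (M : ∀ k, Matrix (m k) (m k) R) :
    (Matrix.blockDiagonal' M).det = ∏ k, (M k).det := by
  rw [(Matrix.blockTriangular_blockDiagonal' M).det_fintype]
  refine Finset.prod_congr rfl fun k _ => ?_
  rw [← Matrix.det_submatrix_equiv_self (Equiv.sigmaSubtype k).symm]
  congr 1
  ext a b
  exact Matrix.blockDiagonal'_apply_eq M k a b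

theorem det_pretzelCore (N I : ℕ) (i : ℕ → ℕ) :
    (pretzelCore N I i).det =
      (∏ l ∈ Finset.Icc 1 (N - 1), (oddBlock (2 * i l)).det) * (evenBlock'' I (2 * i N)).det := by
  rw [pretzelCore, Matrix.det_fromBlocks_zero₂₁, det_blockDiagonal'_eq_prod,
    ← Finset.prod_coe_sort (Finset.Icc 1 (N - 1)) fun l => (oddBlock (2 * i l)).det]

/-- `det pretzelCore` times the formal solution of `pretzelCore *ᵥ w = pretzelCol`. -/
def pretzelSolution (N I : ℕ) (i : ℕ → ℕ) :
    (Σ k : Finset.Icc 1 (N - 1), Fin (2 * i k)) ⊕ Fin (2 * i N - 1) → ℤ[X] :=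
  Sum.elim
    (fun x => ((∏ l ∈ (Finset.Icc 1 (N - 1)).erase x.1, (oddBlock (2 * i l)).det) *
        (evenBlock'' I (2 * i N)).det) *
      (oddBlock (2 * i x.1)).cramer (fun a => if (a : ℕ) + 1 = 2 * i x.1 then X else 0) x.2)
    fun a => (∏ l ∈ Finset.Icc 1 (N - 1), (oddBlock (2 * i l)).det) *
      (evenBlock'' I (2 * i N)).cramer (fun _ => -1) a

theorem pretzelCore_mulVec_solution (N I : ℕ) (i : ℕ → ℕ) :
    (pretzelCore N I i).mulVec (pretzelSolution N I i) =
      (pretzelCore N I i).det • pretzelCol N i := by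
  ext1 x
  rw [det_pretzelCore, pretzelCore, Matrix.fromBlocks_mulVec]
  rcases x with ⟨k, a⟩ | a
  · have h := congrFun (Matrix.mulVec_cramer (oddBlock (2 * i k))
      (fun a => if (a : ℕ) + 1 = 2 * i k then X else 0)) a
    simp only [Matrix.mulVec, dotProduct, Pi.smul_apply, smul_eq_mul] at h
    simp only [Sum.elim_inl, Matrix.zero_mulVec, add_zero, Matrix.mulVec, dotProduct,
      Function.comp_apply, pretzelSolution, Pi.smul_apply, smul_eq_mul, pretzelCol,
      Fintype.sum_sigma]
    rw [Finset.sum_eq_single k]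
    · simp only [Matrix.blockDiagonal'_apply_eq]
      rw [← Finset.mul_prod_erase _ _ k.2]
      refine Eq.trans ?_ ((congrArg (((∏ l ∈ (Finset.Icc 1 (N - 1)).erase k,
        (oddBlock (2 * i l)).det) * (evenBlock'' I (2 * i N)).det) * ·) h).trans (by ring))
      rw [Finset.mul_sum]
      exact Finset.sum_congr rfl fun b _ => by ring
    · intro l _ hl
      exact Finset.sum_eq_zero fun b _ => by
        rw [Matrix.blockDiagonal'_apply_ne _ _ _ hl.symm, zero_mul]
    · simp
  · have h := congrFun (Matrix.mulVec_cramer (evenBlock'' I (2 * i N)) (fun _ => -1)) a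
    simp only [Matrix.mulVec, dotProduct, Pi.smul_apply, smul_eq_mul] at h
    simp only [Sum.elim_inr, Matrix.zero_mulVec, zero_add, Matrix.mulVec, dotProduct,
      Function.comp_apply, pretzelSolution, Pi.smul_apply, smul_eq_mul, pretzelCol]
    rw [mul_assoc, ← h, Finset.mul_sum]
    exact Finset.sum_congr rfl fun b _ => by ring

theorem cramer_oddBlock_last {m : ℕ} (a : Fin m) (ha : (a : ℕ) + 1 = m) :
    (oddBlock m).cramer (fun a => if (a : ℕ) + 1 = m then X else 0) a = (oddBlock' m).det := by
  rw [Matrix.cramer_apply]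
  congr 1
  ext1 b c
  rw [Matrix.updateCol_apply]
  simp only [oddBlock, oddBlock', oddBlockEntry', Matrix.of_apply]
  by_cases hc : c = a
  · subst hc
    simp [ha]
  · rw [if_neg hc, if_neg (fun h => hc (Fin.ext (by omega)))]

theorem cramer_evenBlock''_last (I : ℕ) {m : ℕ} (a : Fin (m - 1)) (ha : (a : ℕ) + 2 = m) :
    (evenBlock'' I m).cramer (fun _ => -1) a = (evenBlock' I m).det := by
  rw [Matrix.cramer_apply]
  congr 1
  ext1 b c
  rw [Matrix.updateCol_apply]
  simp only [evenBlock'', evenBlock', Matrix.of_apply]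
  have := b.isLt
  by_cases hc : c = a
  · subst hc
    rw [if_pos rfl, if_pos ha, evenBlockEntry, if_pos (by omega), if_neg (by omega)]
  · rw [if_neg hc, if_neg (fun h => hc (Fin.ext (by omega)))]

theorem pretzelRow_dotProduct_solution (N I : ℕ) (i : ℕ → ℕ)
    (hpos : ∀ k, 1 ≤ k → k ≤ N - 1 → 0 < i k) (hiN : 0 < i N) :
    pretzelRow N i ⬝ᵥ pretzelSolution N I i =
      (X : ℤ[X]) * (evenBlock' I (2 * i N)).det *
          ∏ l ∈ Finset.Icc 1 (N - 1), (oddBlock (2 * i l)).det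
        - (evenBlock'' I (2 * i N)).det *
          ∑ j ∈ Finset.Icc 1 (N - 1), (oddBlock' (2 * i j)).det *
            ∏ l ∈ (Finset.Icc 1 (N - 1)).erase j, (oddBlock (2 * i l)).det := by
  rw [dotProduct, Fintype.sum_sum_type, Fintype.sum_sigma,
    ← Finset.sum_coe_sort (Finset.Icc 1 (N - 1)) fun j => (oddBlock' (2 * i j)).det *
            ∏ l ∈ (Finset.Icc 1 (N - 1)).erase j, (oddBlock (2 * i l)).det, sub_eq_add_neg,
    add_comm, Finset.mul_sum, ← Finset.sum_neg_distrib]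
  simp only [pretzelRow, pretzelSolution, Sum.elim_inl, Sum.elim_inr]
  congr 1
  · let a : Fin (2 * i N - 1) := ⟨2 * i N - 2, by omega⟩
    have ha : (a : ℕ) + 2 = 2 * i N := by simp only [a]; omega
    rw [Finset.sum_eq_single a, if_pos ha, cramer_evenBlock''_last I a ha]
    · ring
    · intro b _ hb
      rw [if_neg fun h => hb (Fin.ext (by omega)), zero_mul]
    · simp
  · refine Finset.sum_congr rfl fun k _ => ?_
    have hk := Finset.mem_Icc.1 k.2
    have hk0 := hpos k hk.1 hk.2
    let a : Fin (2 * i k) := ⟨2 * i k - 1, by omega⟩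
    have ha : (a : ℕ) + 1 = 2 * i k := by simp only [a]; omega
    rw [Finset.sum_eq_single a, if_pos ha, cramer_oddBlock_last a ha]
    · ring
    · intro b _ hb
      rw [if_neg fun h => hb (Fin.ext (by omega)), zero_mul]
    · simp

theorem pretzelM1_apply (N : ℕ) (hN : 1 ≤ N) (i : ℕ → ℕ) (hiN : 0 < i N)
    (hpos : ∀ k, 1 ≤ k → k ≤ N - 1 → 0 < i k) (x y : BlockIndex N i) :
    pretzelM1 N i (blockEquiv hN i hiN x) (blockEquiv hN i hiN y) =
      Sum.elim (fun x => Sum.elim (fun _ => 0)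
          (fun _ => Sum.elim (fun x => if (x.2 : ℕ) + 1 = 2 * i x.1 then X else 0) 0 x) y)
        (fun _ => Sum.elim
          (Sum.elim (fun y => if (y.2 : ℕ) + 1 = 2 * i y.1 then -1 else 0) 0) 0 y) x := by
  have hlast : ∀ z : BlockIndex N i, blockPosition N i z + 1 = blockOffset i N ↔ z = .inr () := by
    intro z
    rw [← (blockPosition_injective N i).eq_iff]
    have := blockOffset_eq i hN
    have h : blockPosition N i (.inr ()) = blockOffset i (N - 1) + (2 * i N - 1) := rfl
    rw [h]
    omega
  have hend : ∀ z : BlockIndex N i, (∃ k ∈ Finset.Icc 1 (N - 1),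
      blockPosition N i z + 1 = blockOffset i k) ↔
      ∃ (k : Finset.Icc 1 (N - 1)) (a : Fin (2 * i k)),
        (a : ℕ) + 1 = 2 * i k ∧ z = .inl (.inl ⟨k, a⟩) := by
    intro z
    constructor
    · rintro ⟨k, hk, h⟩
      have hk' := Finset.mem_Icc.1 hk
      have := hpos k hk'.1 hk'.2
      have hz : blockPosition N i (.inl (.inl ⟨⟨k, hk⟩, ⟨2 * i k - 1, by simp only; omega⟩⟩)) =
          blockOffset i (k - 1) + (2 * i k - 1) := rfl
      have := blockOffset_eq i hk'.1
      exact ⟨⟨k, hk⟩, ⟨2 * i k - 1, by simp only; omega⟩, by simp only; omega,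
        blockPosition_injective N i (by rw [hz]; omega)⟩
    · rintro ⟨k, a, ha, rfl⟩
      refine ⟨k, k.2, ?_⟩
      have := blockOffset_eq i (Finset.mem_Icc.1 k.2).1
      simp only [blockPosition]
      omega
  have h : pretzelM1 N i (blockEquiv hN i hiN x) (blockEquiv hN i hiN y) =
      (if blockPosition N i x + 1 = blockOffset i N ∧ ∃ k ∈ Finset.Icc 1 (N - 1),
        blockPosition N i y + 1 = blockOffset i k then (-1 : ℤ[X]) else 0) +
      if blockPosition N i y + 1 = blockOffset i N ∧ ∃ k ∈ Finset.Icc 1 (N - 1),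
        blockPosition N i x + 1 = blockOffset i k then (X : ℤ[X]) else 0 := rfl
  rw [h]
  have hodd : ∀ (k : Finset.Icc 1 (N - 1)) (a : Fin (2 * i k)),
      (∃ (k' : Finset.Icc 1 (N - 1)) (a' : Fin (2 * i k')),
        (a' : ℕ) + 1 = 2 * i k' ∧
          (.inl (.inl ⟨k, a⟩) : BlockIndex N i) = .inl (.inl ⟨k', a'⟩)) ↔
      (a : ℕ) + 1 = 2 * i k := by
    refine fun k a => ⟨?_, fun h => ⟨k, a, h, rfl⟩⟩
    rintro ⟨_, _, h, h'⟩
    cases h'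
    exact h
  simp only [hlast, hend]
  rcases x with (⟨k, a⟩ | a) | _ <;> rcases y with (⟨l, b⟩ | b) | _ <;>
    (try simp only [hodd]) <;> simp

theorem submatrix_blockEquiv (N I : ℕ) (hN : 1 ≤ N) (i : ℕ → ℕ)
    (hpos : ∀ k, 1 ≤ k → k ≤ N - 1 → 0 < i k) (hiN : 0 < i N) :
    (pretzelM1 N i + pretzelM2 N I i).submatrix (blockEquiv hN i hiN) (blockEquiv hN i hiN) =
      Matrix.fromBlocks (pretzelCore N I i) (Matrix.of fun a (_ : Unit) => pretzelCol N i a)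
        (Matrix.of fun (_ : Unit) b => pretzelRow N i b)
        (Matrix.of fun (_ _ : Unit) => (I : ℤ[X]) - (I : ℤ[X]) * X) := by
  have hrange : ∀ (k : Finset.Icc 1 (N - 1)) (a : Fin (2 * i k)),
      blockOffset i (k - 1) + a < blockOffset i k ∧
        blockOffset i k ≤ blockOffset i (N - 1) := fun k a => by
    have hk := Finset.mem_Icc.1 k.2
    have := blockOffset_eq i hk.1
    have := a.isLt
    exact ⟨by omega, blockOffset_mono i hk.2⟩
  have hNN := blockOffset_eq i hN
  have hNmem : N ∈ Finset.Icc 1 N := Finset.mem_Icc.2 ⟨hN, le_rfl⟩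
  have hval : ∀ z, ((blockEquiv hN i hiN z : Fin _) : ℕ) = blockPosition N i z := fun _ => rfl
  have hodd : ∀ (k : Finset.Icc 1 (N - 1)) (a : Fin (2 * i k)),
      blockPosition N i (.inl (.inl ⟨k, a⟩)) = blockOffset i (k - 1) + a := fun _ _ => rfl
  have heven : ∀ a, blockPosition N i (.inl (.inr a)) = blockOffset i (N - 1) + a := fun _ => rfl
  have hlast : ∀ a, blockPosition N i (.inr a) = blockOffset i (N - 1) + (2 * i N - 1) :=
    fun _ => rfl
  ext1 x y
  rw [Matrix.submatrix_apply, Matrix.add_apply, pretzelM1_apply N hN i hiN hpos]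
  rcases x with (⟨k, a⟩ | a) | _
  · have hk := Finset.mem_Icc.1 k.2
    have hka := hrange k a
    rw [pretzelM2_apply N I i (k := k) (Finset.mem_Icc.2 ⟨hk.1, by omega⟩) _ _
      (by rw [hval]; simp only [hodd]; omega)
      (by rw [hval]; simp only [hodd]; omega), if_neg (show ¬ (k : ℕ) = N by omega)]
    simp only [hval]
    rcases y with (⟨l, b⟩ | b) | _
    · have hlb := hrange l b
      simp only [hodd]
      by_cases hlk : k = l
      · subst hlk
        rw [if_pos ⟨by omega, by omega⟩]
        simp [pretzelCore, oddBlock]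
      · rw [if_neg]
        · simp [pretzelCore, Matrix.blockDiagonal'_apply_ne _ _ _ hlk]
        · rintro ⟨h1, h2⟩
          exact hlk (Subtype.ext (eq_of_mem_block i h1 h2 (Nat.le_add_right _ _) hlb.1))
    · simp only [hodd, heven]
      rw [if_neg (by omega)]
      simp [pretzelCore]
    · simp only [hodd, hlast]
      rw [if_neg (by omega)]
      simp [pretzelCol]
  · have ha := a.isLt
    rw [pretzelM2_apply N I i hNmem _ _
      (by rw [hval]; simp only [heven]; omega)
      (by rw [hval]; simp only [heven]; omega), if_pos rfl]
    simp only [hval]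
    rcases y with (⟨l, b⟩ | b) | _
    · have hlb := hrange l b
      simp only [hodd, heven]
      rw [if_neg (by omega)]
      simp [pretzelCore]
    · have hb := b.isLt
      simp only [heven]
      rw [if_pos (by omega)]
      simp [pretzelCore, evenBlock'']
    · simp only [heven, hlast]
      rw [if_pos (by omega)]
      simp only [Nat.add_sub_cancel_left, evenBlockEntry]
      rw [if_pos (by omega), if_neg (by omega)]
      simp [pretzelCol]
  · rw [pretzelM2_apply N I i hNmem _ _
      (by rw [hval]; simp only [hlast]; omega)
      (by rw [hval]; simp only [hlast]; omega), if_pos rfl]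
    simp only [hval]
    rcases y with (⟨l, b⟩ | b) | _
    · have hlb := hrange l b
      simp only [hodd, hlast]
      rw [if_neg (by omega)]
      simp [pretzelRow]
    · have hb := b.isLt
      simp only [heven, hlast]
      rw [if_pos (by omega)]
      simp only [Nat.add_sub_cancel_left, evenBlockEntry]
      rw [if_neg (by omega), if_pos (show 2 * i N - 1 + 1 = 2 * i N by omega)]
      by_cases hb2 : (b : ℕ) + 2 = 2 * i N
      · simp [pretzelRow, hb2]
      · rw [if_neg hb2, if_neg (by omega), if_neg (by omega)]
        simp [pretzelRow, hb2]
    · simp only [hlast]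
      rw [if_pos (by omega)]
      simp only [Nat.add_sub_cancel_left, evenBlockEntry]
      rw [if_pos (by omega), if_pos (by omega)]
      simp

/-- Let `N = 2 I ≥ 4` be even, let `i 1, …, i (N-1)` be positive
integers and `i N > 1`.  With the blocks and the matrices `M_1`, `M_2` as above,
`det (M_1 + M_2) = det B''_N · ∑_{j=1}^{N-1} (det B'_j · ∏_{l ≠ j} det B_l)
  - t · det B'_N · ∏_{l=1}^{N-1} det B_l
  + (I - I t) · det B''_N · ∏_{l=1}^{N-1} det B_l`. -/
theorem pretzel_one_even_tassel_alexander (N I : ℕ) (hN : 4 ≤ N) (hNI : N = 2 * I)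
    (i : ℕ → ℕ) (hpos : ∀ k, 1 ≤ k → k ≤ N - 1 → 0 < i k) (hiN : 1 < i N) :
    (pretzelM1 N i + pretzelM2 N I i).det =
      (evenBlock'' I (2 * i N)).det *
          (∑ j ∈ Finset.Icc 1 (N - 1),
            (oddBlock' (2 * i j)).det *
              ∏ l ∈ (Finset.Icc 1 (N - 1)).erase j, (oddBlock (2 * i l)).det)
        - (X : ℤ[X]) * (evenBlock' I (2 * i N)).det *
            ∏ l ∈ Finset.Icc 1 (N - 1), (oddBlock (2 * i l)).det
        + ((I : ℤ[X]) - (I : ℤ[X]) * X) * (evenBlock'' I (2 * i N)).det *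
            ∏ l ∈ Finset.Icc 1 (N - 1), (oddBlock (2 * i l)).det := by
  have hN1 : 1 ≤ N := by omega
  have hiN0 : 0 < i N := by omega
  have hcore : (pretzelCore N I i).det ≠ 0 := by
    rw [det_pretzelCore]
    exact mul_ne_zero (Finset.prod_ne_zero_iff.2 fun l _ => det_oddBlock_ne_zero _)
      (det_evenBlock''_ne_zero _ _)
  rw [← Matrix.det_submatrix_equiv_self (blockEquiv hN1 i hiN0),
    submatrix_blockEquiv N I hN1 i hpos hiN0,
    det_bordered_of_mulVec_eq _ _ _ _ _ hcore (pretzelCore_mulVec_solution N I i),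
    pretzelRow_dotProduct_solution N I i hpos hiN0, det_pretzelCore]
  ring
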